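/- Let l ∈ {1, 2} and κ > 0. Define ṽ_l^κ(r) = i · D_l( exp(e^{-i 3π/4} κ r) - exp(e^{i 3π/4} κ r) ). Then ṽ_l^κ is real-valued, square integrable on (0,∞), and satisfies the fourth-order equation (T_l^2 ṽ_l^κ)(r) = -κ^4 ṽ_l^κ(r) for all r > 0. -/

import Mathlib

open Set MeasureTheory

/-- The `l`-th order differential operation
`(D_l w)(r) = r^(l+1) ((1/r) d/dr)^l (w(r)/r)` on `(0,∞)`. -/
noncomputable def Dop (l : ℕ) (w : ℝ → ℂ) : ℝ → ℂ :=
  fun r => (r : ℂ) ^ (l + 1) *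
    ((fun f : ℝ → ℂ => fun s : ℝ => ((s : ℂ))⁻¹ * deriv f s)^[l]
      (fun s : ℝ => w s / (s : ℂ))) r

/-- The second-order differential operation
`(T_l u)(r) = -u''(r) + l(l+1) u(r)/r^2` on `(0,∞)`. -/
noncomputable def Tl (l : ℕ) (u : ℝ → ℂ) : ℝ → ℂ :=
  fun r => -(deriv (deriv u) r) + ((l : ℂ) * ((l : ℂ) + 1)) * u r / (r : ℂ) ^ 2

/-- The (unnormalized) discrete-spectrum eigenfunction
`ṽ_l^κ = i D_l(exp(e^{-i3π/4} κ r) - exp(e^{i3π/4} κ r))`. -/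
noncomputable def vTilde (l : ℕ) (κ : ℝ) : ℝ → ℂ :=
  fun r => Complex.I * Dop l (fun s =>
    Complex.exp (Complex.exp (-Complex.I * (3 * Real.pi / 4)) * κ * s)
      - Complex.exp (Complex.exp (Complex.I * (3 * Real.pi / 4)) * κ * s)) r

/-- Closed form of `D_l` applied to `r ↦ exp (a r)` for `l ∈ {1,2}`. -/
noncomputable def dopExp (l : ℕ) (a : ℂ) (r : ℝ) : ℂ :=
  if l = 1 then (a - (r : ℂ)⁻¹) * Complex.exp (a * r)
  else (a ^ 2 - 3 * a * (r : ℂ)⁻¹ + 3 * (r : ℂ)⁻¹ ^ 2) * Complex.exp (a * r)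

lemma hasDerivAt_cexp_mul_ofReal (a : ℂ) (r : ℝ) :
    HasDerivAt (fun s : ℝ => Complex.exp (a * s)) (Complex.exp (a * r) * a) r := by
  simpa using ((hasDerivAt_id (r : ℂ)).const_mul a).cexp.comp_ofReal

lemma hasDerivAt_ofReal_inv {r : ℝ} (hr : r ≠ 0) :
    HasDerivAt (fun s : ℝ => ((s : ℂ))⁻¹) (-((r : ℂ) ^ 2)⁻¹) r :=
  (hasDerivAt_inv (Complex.ofReal_ne_zero.mpr hr)).comp_ofReal

lemma exists_hasDerivAt_dopExp {l : ℕ} (hl : l = 1 ∨ l = 2) (a : ℂ) :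
    ∃ D : ℝ → ℂ, ∀ r : ℝ, 0 < r → HasDerivAt (dopExp l a) (D r) r ∧
      HasDerivAt D (((l : ℂ) * ((l : ℂ) + 1) / (r : ℂ) ^ 2 + a ^ 2) * dopExp l a r) r := by
  rcases hl with rfl | rfl
  · refine ⟨fun r => (a ^ 2 - a * (r : ℂ)⁻¹ + (r : ℂ)⁻¹ ^ 2) * Complex.exp (a * r),
      fun r hr => ⟨?_, ?_⟩⟩
    all_goals
      have hr' : (r : ℂ) ≠ 0 := Complex.ofReal_ne_zero.mpr hr.ne'
      have hi := hasDerivAt_ofReal_inv hr.ne'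
      have he := hasDerivAt_cexp_mul_ofReal a r
    · have hE : dopExp 1 a = fun s : ℝ => (a - (s : ℂ)⁻¹) * Complex.exp (a * s) := by
        funext s; simp [dopExp]
      rw [hE]
      refine HasDerivAt.congr_deriv ((hi.const_sub a).fun_mul he) ?_
      field_simp
      ring
    · refine HasDerivAt.congr_deriv ((((hi.const_mul a).const_sub (a ^ 2)).fun_add
        (hi.fun_pow 2)).fun_mul he) ?_
      simp only [dopExp, if_true]
      norm_num
      field_simp
      ring
  · refine ⟨fun r => (a ^ 3 - 3 * a ^ 2 * (r : ℂ)⁻¹ + 6 * a * (r : ℂ)⁻¹ ^ 2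
      - 6 * (r : ℂ)⁻¹ ^ 3) * Complex.exp (a * r), fun r hr => ⟨?_, ?_⟩⟩
    all_goals
      have hr' : (r : ℂ) ≠ 0 := Complex.ofReal_ne_zero.mpr hr.ne'
      have hi := hasDerivAt_ofReal_inv hr.ne'
      have he := hasDerivAt_cexp_mul_ofReal a r
    · have hE : dopExp 2 a = fun s : ℝ =>
          (a ^ 2 - 3 * a * (s : ℂ)⁻¹ + 3 * (s : ℂ)⁻¹ ^ 2) * Complex.exp (a * s) := by
        funext s; simp [dopExp]
      rw [hE]
      refine HasDerivAt.congr_deriv ((((hi.const_mul (3 * a)).const_sub (a ^ 2)).fun_add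
        ((hi.fun_pow 2).const_mul 3)).fun_mul he) ?_
      norm_num
      field_simp
      ring
    · refine HasDerivAt.congr_deriv (((((hi.const_mul (3 * a ^ 2)).const_sub (a ^ 3)).fun_add
        ((hi.fun_pow 2).const_mul (6 * a))).fun_sub ((hi.fun_pow 3).const_mul 6)).fun_mul he) ?_
      simp only [dopExp]
      norm_num
      field_simp
      ring

lemma Tl_eqOn_of_eqOn_dopExp {l : ℕ} (hl : l = 1 ∨ l = 2) {a b A B : ℂ} {u : ℝ → ℂ}
    (hu : EqOn u (fun r => A * dopExp l a r + B * dopExp l b r) (Ioi 0)) :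
    EqOn (Tl l u) (fun r => (-a ^ 2 * A) * dopExp l a r + (-b ^ 2 * B) * dopExp l b r)
      (Ioi 0) := by
  obtain ⟨D, hD⟩ := exists_hasDerivAt_dopExp hl a
  obtain ⟨D', hD'⟩ := exists_hasDerivAt_dopExp hl b
  have h1 : EqOn (deriv u) (fun r => A * D r + B * D' r) (Ioi 0) := fun r hr => by
    rw [(hu.eventuallyEq_of_mem (Ioi_mem_nhds hr)).deriv_eq]
    exact (((hD r hr).1.const_mul A).fun_add ((hD' r hr).1.const_mul B)).deriv
  intro r hr
  have hr' : (r : ℂ) ≠ 0 := Complex.ofReal_ne_zero.mpr (ne_of_gt hr)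
  simp only [Tl]
  rw [(h1.eventuallyEq_of_mem (Ioi_mem_nhds hr)).deriv_eq,
    (((hD r hr).2.const_mul A).fun_add ((hD' r hr).2.const_mul B)).deriv, hu hr]
  field_simp
  ring

lemma Dop_exp_sub_exp {l : ℕ} (hl : l = 1 ∨ l = 2) (a b : ℂ) :
    EqOn (Dop l (fun s => Complex.exp (a * s) - Complex.exp (b * s)))
      (fun r => dopExp l a r - dopExp l b r) (Ioi 0) := by
  have h1 : EqOn (fun s : ℝ => ((s : ℂ))⁻¹ *
      deriv (fun s : ℝ => (Complex.exp (a * s) - Complex.exp (b * s)) / (s : ℂ)) s)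
      (fun s => (a * (s : ℂ)⁻¹ ^ 2 - (s : ℂ)⁻¹ ^ 3) * Complex.exp (a * s)
        - (b * (s : ℂ)⁻¹ ^ 2 - (s : ℂ)⁻¹ ^ 3) * Complex.exp (b * s)) (Ioi 0) := fun r hr => by
    have hr' : (r : ℂ) ≠ 0 := Complex.ofReal_ne_zero.mpr (ne_of_gt hr)
    have h := ((hasDerivAt_cexp_mul_ofReal a r).fun_sub (hasDerivAt_cexp_mul_ofReal b r)).fun_mul
      (hasDerivAt_ofReal_inv (ne_of_gt hr))
    simp only [div_eq_mul_inv, h.deriv]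
    field_simp
    ring
  intro r hr
  have hr' : (r : ℂ) ≠ 0 := Complex.ofReal_ne_zero.mpr (ne_of_gt hr)
  rcases hl with rfl | rfl
  · have h := h1 hr
    simp only [Dop, Function.iterate_one] at h ⊢
    rw [h]
    simp only [dopExp, if_true]
    field_simp
  · simp only [Dop, Function.iterate_succ, Function.iterate_zero, Function.comp_apply, id]
    rw [(h1.eventuallyEq_of_mem (Ioi_mem_nhds hr)).deriv_eq]
    have hi := hasDerivAt_ofReal_inv (ne_of_gt hr)
    have hp := fun c : ℂ => (((hi.fun_pow 2).const_mul c).fun_sub (hi.fun_pow 3)).fun_mul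
      (hasDerivAt_cexp_mul_ofReal c r)
    rw [((hp a).fun_sub (hp b)).deriv]
    simp only [dopExp]
    norm_num
    field_simp
    ring

lemma dopExp_conj (l : ℕ) (a : ℂ) (r : ℝ) :
    dopExp l (starRingEnd ℂ a) r = starRingEnd ℂ (dopExp l a r) := by
  unfold dopExp
  split_ifs <;> simp [← Complex.exp_conj, map_ofNat]

lemma continuousOn_dopExp {l : ℕ} (hl : l = 1 ∨ l = 2) (a : ℂ) :
    ContinuousOn (dopExp l a) (Ioi 0) := by
  obtain ⟨D, hD⟩ := exists_hasDerivAt_dopExp hl a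
  exact fun r hr => (hD r hr).1.continuousAt.continuousWithinAt

/-- The singular part of `dopExp l a` at the origin does not depend on `a`. -/
lemma norm_dopExp_sub_singular_le {l : ℕ} (hl : l = 1 ∨ l = 2) {a : ℂ} {r : ℝ} (hr : 0 < r)
    (har : ‖a‖ * r ≤ 1) :
    ‖dopExp l a r - (if l = 1 then -(r : ℂ)⁻¹ else 3 * (r : ℂ)⁻¹ ^ 2)‖ ≤ 10 * ‖a‖ ^ l := by
  have hr' : (r : ℂ) ≠ 0 := Complex.ofReal_ne_zero.mpr hr.ne'
  have hz : ‖a * r‖ = ‖a‖ * r := by simp [abs_of_pos hr]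
  have hR := Complex.norm_exp_sub_one_sub_id_le (hz.le.trans har)
  rw [hz] at hR
  set R := Complex.exp (a * r) - 1 - a * r with hRdef
  have hexp : Complex.exp (a * r) = R + 1 + a * r := by rw [hRdef]; ring
  have ht : 0 ≤ ‖a‖ * r := by positivity
  rcases hl with rfl | rfl
  · have h : dopExp 1 a r - (if 1 = 1 then -(r : ℂ)⁻¹ else 3 * (r : ℂ)⁻¹ ^ 2) =
        ((a * r) ^ 2 + (a * r - 1) * R) * (r : ℂ)⁻¹ := by
      simp only [dopExp, if_true, hexp]
      field_simp
      ring
    rw [h, norm_mul, norm_inv, Complex.norm_of_nonneg hr.le, ← div_eq_mul_inv, div_le_iff₀ hr]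
    have h1 : ‖a * r - 1‖ ≤ 2 := (norm_sub_le _ _).trans (by rw [hz, norm_one]; linarith)
    calc ‖(a * r) ^ 2 + (a * r - 1) * R‖ ≤ (‖a‖ * r) ^ 2 + 2 * (‖a‖ * r) ^ 2 := by
          refine (norm_add_le _ _).trans ?_
          rw [norm_pow, norm_mul (a * r - 1), hz]
          gcongr
      _ ≤ 10 * ‖a‖ ^ 1 * r := by nlinarith
  · have h : dopExp 2 a r - (if 2 = 1 then -(r : ℂ)⁻¹ else 3 * (r : ℂ)⁻¹ ^ 2) =
        ((a * r) ^ 2 * (a * r - 2) + ((a * r) ^ 2 - 3 * (a * r) + 3) * R) * (r : ℂ)⁻¹ ^ 2 := by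
      simp only [dopExp, hexp]
      norm_num
      field_simp
      ring
    rw [h, norm_mul, norm_pow, norm_inv, Complex.norm_of_nonneg hr.le, inv_pow, ← div_eq_mul_inv,
      div_le_iff₀ (by positivity)]
    have h1 : ‖a * r - 2‖ ≤ 3 :=
      (norm_sub_le _ _).trans (by rw [hz, Complex.norm_ofNat]; linarith)
    have h2 : ‖(a * r) ^ 2 - 3 * (a * r) + 3‖ ≤ 7 := by
      refine (norm_add_le _ _).trans ((add_le_add_left (norm_sub_le _ _) _).trans ?_)
      rw [norm_pow, norm_mul 3, hz, Complex.norm_ofNat]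
      nlinarith
    calc ‖(a * r) ^ 2 * (a * r - 2) + ((a * r) ^ 2 - 3 * (a * r) + 3) * R‖
        ≤ (‖a‖ * r) ^ 2 * 3 + 7 * (‖a‖ * r) ^ 2 := by
          refine (norm_add_le _ _).trans ?_
          rw [norm_mul, norm_pow, norm_mul _ R, hz]
          gcongr
      _ = 10 * ‖a‖ ^ 2 * r ^ 2 := by ring

lemma norm_dopExp_le {l : ℕ} (hl : l = 1 ∨ l = 2) {a : ℂ} {r : ℝ} (hr : 0 < r)
    (har : 1 ≤ ‖a‖ * r) : ‖dopExp l a r‖ ≤ 10 * ‖a‖ ^ l * Real.exp (a.re * r) := by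
  have hinv : ‖(r : ℂ)⁻¹‖ ≤ ‖a‖ := by
    rw [norm_inv, Complex.norm_of_nonneg hr.le]
    exact (inv_le_iff_one_le_mul₀ hr).mpr har
  have hexp : ‖Complex.exp (a * r)‖ = Real.exp (a.re * r) := by simp [Complex.norm_exp]
  rcases hl with rfl | rfl
  · simp only [dopExp, if_true, norm_mul, hexp]
    gcongr
    refine (norm_sub_le _ _).trans ?_
    linarith [norm_nonneg a]
  · have hE : dopExp 2 a r =
        (a ^ 2 - 3 * a * (r : ℂ)⁻¹ + 3 * (r : ℂ)⁻¹ ^ 2) * Complex.exp (a * r) := by simp [dopExp]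
    rw [hE, norm_mul, hexp]
    gcongr
    calc ‖a ^ 2 - 3 * a * (r : ℂ)⁻¹ + 3 * (r : ℂ)⁻¹ ^ 2‖
        ≤ ‖a ^ 2‖ + ‖3 * a * (r : ℂ)⁻¹‖ + ‖3 * (r : ℂ)⁻¹ ^ 2‖ :=
          (norm_add_le _ _).trans (add_le_add_left (norm_sub_le _ _) _)
      _ = ‖a‖ ^ 2 + 3 * ‖a‖ * ‖(r : ℂ)⁻¹‖ + 3 * ‖(r : ℂ)⁻¹‖ ^ 2 := by
          simp only [norm_mul, norm_pow, Complex.norm_ofNat]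
      _ ≤ ‖a‖ ^ 2 + 3 * ‖a‖ * ‖a‖ + 3 * ‖a‖ ^ 2 := by gcongr
      _ ≤ 10 * ‖a‖ ^ 2 := by nlinarith [sq_nonneg ‖a‖]

lemma norm_dopExp_sub_le {l : ℕ} (hl : l = 1 ∨ l = 2) {a b : ℂ} (hab : ‖b‖ = ‖a‖)
    (hre : b.re = a.re) {r : ℝ} (hr : 0 < r) :
    ‖dopExp l a r - dopExp l b r‖ ≤ 20 * ‖a‖ ^ l * Real.exp 1 * Real.exp (a.re * r) := by
  rcases le_total (‖a‖ * r) 1 with h | h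
  · have ha := norm_dopExp_sub_singular_le hl hr h
    have hb := norm_dopExp_sub_singular_le (a := b) hl hr (by rwa [hab])
    rw [hab] at hb
    have hexp : 1 ≤ Real.exp 1 * Real.exp (a.re * r) := by
      rw [← Real.exp_add]
      refine Real.one_le_exp ?_
      nlinarith [(abs_le.mp (Complex.abs_re_le_norm a)).1]
    calc ‖dopExp l a r - dopExp l b r‖ ≤ 20 * ‖a‖ ^ l * 1 := by
          rw [← sub_sub_sub_cancel_right _ _
            (if l = 1 then -(r : ℂ)⁻¹ else 3 * (r : ℂ)⁻¹ ^ 2)]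
          refine (norm_sub_le _ _).trans ?_
          linarith
      _ ≤ 20 * ‖a‖ ^ l * Real.exp 1 * Real.exp (a.re * r) := by
          rw [mul_assoc (20 * ‖a‖ ^ l)]
          gcongr
  · have ha := norm_dopExp_le hl hr h
    have hb := norm_dopExp_le (a := b) hl hr (by rwa [hab])
    rw [hab, hre] at hb
    calc ‖dopExp l a r - dopExp l b r‖ ≤ 20 * ‖a‖ ^ l * 1 * Real.exp (a.re * r) := by
          refine (norm_sub_le _ _).trans ?_
          linarith
      _ ≤ 20 * ‖a‖ ^ l * Real.exp 1 * Real.exp (a.re * r) := by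
          gcongr
          exact Real.one_le_exp zero_le_one

lemma integrableOn_norm_sq_dopExp_sub {l : ℕ} (hl : l = 1 ∨ l = 2) {a b : ℂ} (hab : ‖b‖ = ‖a‖)
    (hre : b.re = a.re) (ha : a.re < 0) :
    IntegrableOn (fun r => ‖dopExp l a r - dopExp l b r‖ ^ 2) (Ioi 0) := by
  have hint : IntegrableOn (fun r : ℝ => (20 * ‖a‖ ^ l * Real.exp 1) ^ 2 *
      Real.exp (2 * a.re * r)) (Ioi 0) :=
    (integrableOn_exp_mul_Ioi (by linarith) 0).const_mul _
  refine hint.mono' ?_ ?_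
  · exact (((continuousOn_dopExp hl a).sub (continuousOn_dopExp hl b)).norm.pow
      2).aestronglyMeasurable measurableSet_Ioi
  · filter_upwards [ae_restrict_mem measurableSet_Ioi] with r hr
    rw [Real.norm_of_nonneg (by positivity)]
    calc _ ≤ (20 * ‖a‖ ^ l * Real.exp 1 * Real.exp (a.re * r)) ^ 2 := by
          gcongr
          exact norm_dopExp_sub_le hl hab hre hr
      _ = _ := by
          rw [mul_pow _ (Real.exp (a.re * r)), ← Real.exp_nat_mul]
          push_cast
          rw [mul_assoc 2]

/-- For `l ∈ {1,2}` and `κ > 0`, the function `ṽ_l^κ` is real-valued, square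
integrable on `(0,∞)`, and satisfies `T_l² ṽ_l^κ = -κ⁴ ṽ_l^κ` there. -/
theorem stmt11 (l : ℕ) (hl : l = 1 ∨ l = 2) (κ : ℝ) (hκ : 0 < κ) :
    (∀ r ∈ Ioi (0 : ℝ), (vTilde l κ r).im = 0) ∧
    IntegrableOn (fun r => ‖vTilde l κ r‖ ^ 2) (Ioi 0) ∧
    ∀ r ∈ Ioi (0 : ℝ),
      Tl l (Tl l (vTilde l κ)) r = -(κ : ℂ) ^ 4 * vTilde l κ r := by
  set a : ℂ := Complex.exp (-Complex.I * (3 * Real.pi / 4)) * κ with ha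
  set b : ℂ := Complex.exp (Complex.I * (3 * Real.pi / 4)) * κ with hb
  have hv : EqOn (vTilde l κ) (fun r => Complex.I * (dopExp l a r - dopExp l b r)) (Ioi 0) :=
    fun r hr => congrArg (Complex.I * ·) (Dop_exp_sub_exp hl a b hr)
  have hconj : b = starRingEnd ℂ a := by
    simp [ha, hb, ← Complex.exp_conj, map_ofNat]
  have hb' : b = Complex.exp ((3 * Real.pi / 4 : ℝ) * Complex.I) * κ := by
    rw [hb]; push_cast; ring_nf
  have hbre : b.re < 0 := by
    rw [hb', Complex.re_mul_ofReal, Complex.exp_ofReal_mul_I_re]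
    exact mul_neg_of_neg_of_pos (Real.cos_neg_of_pi_div_two_lt_of_lt
      (by linarith [Real.pi_pos]) (by linarith [Real.pi_pos])) hκ
  have hb4 : b ^ 4 = -(κ : ℂ) ^ 4 := by
    have h : ((4 : ℕ) : ℂ) * (Complex.I * (3 * Real.pi / 4)) =
        Real.pi * Complex.I + 2 * Real.pi * Complex.I := by push_cast; ring
    rw [hb, mul_pow, ← Complex.exp_nat_mul, h, Complex.exp_add, Complex.exp_pi_mul_I,
      Complex.exp_two_pi_mul_I]
    ring
  have ha4 : a ^ 4 = -(κ : ℂ) ^ 4 := by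
    have h : a = starRingEnd ℂ b := by rw [hconj, Complex.conj_conj]
    rw [h, ← map_pow, hb4]
    simp
  have hre : b.re = a.re := by rw [hconj, Complex.conj_re]
  refine ⟨fun r hr => ?_, ?_, fun r hr => ?_⟩
  · rw [hv hr]
    simp [hconj, dopExp_conj]
  · refine (integrableOn_norm_sq_dopExp_sub hl (by rw [hconj, Complex.norm_conj]) hre
      (hre ▸ hbre)).congr_fun (fun r hr => ?_) measurableSet_Ioi
    simp [hv hr]
  · have h0 : EqOn (vTilde l κ)
        (fun r => Complex.I * dopExp l a r + -Complex.I * dopExp l b r) (Ioi 0) :=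
      fun r hr => by rw [hv hr]; ring
    rw [Tl_eqOn_of_eqOn_dopExp hl (Tl_eqOn_of_eqOn_dopExp hl h0) hr, hv hr]
    linear_combination Complex.I * dopExp l a r * ha4 - Complex.I * dopExp l b r * hb4
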